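/- arXiv:1407.1814 — 9 statements merged into one kernel-verified Lean document; each statement's English description precedes it below -/
import Mathlib

section
/- There exists a 4×4 integer matrix M satisfying Mᵀ·G·M = G and having characteristic polynomial equal to the 5th cyclotomic polynomial Φ₅(X) = X⁴ + X³ + X² + X + 1, where G is the Gram matrix of the lattice U ⊕ H₅; in particular M is an isometry of order 5 of U ⊕ H₅. -/
open Matrix

/-- Gram matrix of the hyperbolic plane `U`. -/
def latU : Matrix (Fin 2) (Fin 2) ℤ := !![0, 1; 1, 0]

/-- Gram matrix of the lattice `H₅`. -/
def latH5 : Matrix (Fin 2) (Fin 2) ℤ := !![2, 1; 1, -2]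

/-- Gram matrix of the lattice `U ⊕ H₅`. -/
def gramUH5 : Matrix (Fin 4) (Fin 4) ℤ :=
  Matrix.reindex finSumFinEquiv finSumFinEquiv (Matrix.fromBlocks latU 0 0 latH5)

/-- The lattice `U ⊕ H₅` admits an isometry whose characteristic
polynomial is the 5th cyclotomic polynomial `Φ₅`; in particular it is an isometry of
order `5`. -/
theorem stmt6 :
    ∃ M : Matrix (Fin 4) (Fin 4) ℤ,
      Mᵀ * gramUH5 * M = gramUH5 ∧ M.charpoly = Polynomial.cyclotomic 5 ℤ ∧
      M ^ 5 = 1 ∧ M ≠ 1 := by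
  refine ⟨!![0, 1, 0, 0; 1, -1, -3, 1; 0, 1, 1, 0; 0, 0, 1, -1], by decide +kernel, ?_,
    by decide +kernel, by decide +kernel⟩
  have : Fact (Nat.Prime 5) := ⟨by norm_num⟩
  rw [Polynomial.cyclotomic_prime, Matrix.charpoly]
  simp [Matrix.charmatrix, Matrix.det_succ_row_zero, Fin.sum_univ_succ, Fin.succAbove,
    Finset.sum_range_succ]
  ring
end

section
/- Let A be the 22×22 symmetric integer matrix with entries A_{ij} = c(|i−j|) for 1 ≤ i,j ≤ 22, where (c(0), c(1), …, c(21)) = (−2, 3, 0, 3, 0, 2, 1, 0, −1, −2, −2, −3, −3, −2, −2, −1, 0, 1, 2, 0, 3, 0), and let C be the companion matrix of the 23rd cyclotomic polynomial Φ₂₃(X) = X²² + X²¹ + ⋯ + X + 1. Then Cᵀ·A·C = A; in particular C is an isometry of order 23 of the lattice with Gram matrix A. -/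
open Matrix

/-- The sequence of values `c(0), …, c(21)` determining the Gram matrix from the appendix
of the paper (entries depend only on `|i - j|`). -/
def cval (n : ℕ) : ℤ :=
  [-2, 3, 0, 3, 0, 2, 1, 0, -1, -2, -2, -3, -3, -2, -2, -1, 0, 1, 2, 0, 3, 0].getD n 0

/-- The explicit `22 × 22` Gram matrix `A` from the appendix of the paper,
`A i j = c |i - j|`. -/
def gramA : Matrix (Fin 22) (Fin 22) ℤ :=
  Matrix.of fun i j : Fin 22 => cval ((i : ℤ) - (j : ℤ)).natAbs

/-- The companion matrix of the 23rd cyclotomic polynomial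
`Φ₂₃ = X²² + X²¹ + ⋯ + X + 1` (subdiagonal entries `1`, last column all `-1`). -/
def comp23 : Matrix (Fin 22) (Fin 22) ℤ :=
  Matrix.of fun i j : Fin 22 =>
    if (i : ℕ) = (j : ℕ) + 1 then 1 else if (j : ℕ) = 21 then -1 else 0

/-- Left multiplication by the companion matrix shifts the rows down and subtracts the last row
from every row. -/
lemma comp23_mul_apply (M : Matrix (Fin 22) (Fin 22) ℤ) (i j : Fin 22) :
    (comp23 * M) i j = (if i = 0 then 0 else M (i - 1) j) - M 21 j := by
  have entry : comp23 = Matrix.of fun i l : Fin 22 =>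
      (if i = 0 then 0 else if l = i - 1 then 1 else 0) - if l = 21 then 1 else 0 := by
    decide +kernel
  simp only [Matrix.mul_apply, entry, Matrix.of_apply, sub_mul, Finset.sum_sub_distrib]
  split_ifs <;> simp

/-- The powers of the companion matrix: multiplication by `ζ ^ k` sends `ζ ^ j` to `ζ ^ (j + k)`,
where `ζ ^ 22 = -(1 + ζ + ⋯ + ζ ^ 21)`. -/
lemma comp23_pow (k : ℕ) :
    comp23 ^ k = Matrix.of fun i j : Fin 22 =>
      (if ((j : ℕ) + k) % 23 = i then 1 else 0) - if ((j : ℕ) + k) % 23 = 22 then 1 else 0 := by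
  induction k with
  | zero =>
    ext i j
    simp only [pow_zero, Matrix.one_apply, Matrix.of_apply, Fin.ext_iff]
    split_ifs <;> omega
  | succ k ih =>
    ext i j
    rw [pow_succ', ih, comp23_mul_apply]
    have h21 : ((21 : Fin 22) : ℕ) = 21 := rfl
    have h0 : i = 0 ↔ (i : ℕ) = 0 := Fin.ext_iff
    by_cases h : i = 0
    · rw [h0] at h
      simp only [Matrix.of_apply, h21, h0, h, if_true]
      split_ifs <;> omega
    · simp only [Matrix.of_apply, h21, h, if_false, Fin.val_sub_one_of_ne_zero h]
      rw [h0] at h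
      split_ifs <;> omega

/-- Right multiplication by the companion matrix shifts the columns of the Gram matrix to the left;
the entry `3` is the value `c(22) = c(1)` extending the sequence by `c(n) = c(23 - n)`. -/
lemma gramA_mul_comp23 :
    gramA * comp23 = Matrix.of fun i j : Fin 22 =>
      if ((i : ℤ) - (j + 1)).natAbs = 22 then 3 else cval ((i : ℤ) - (j + 1)).natAbs := by
  decide +kernel

/-- The companion matrix `C` of `Φ₂₃` preserves the bilinear form `A`;
in particular `C` is an isometry of order `23` of the lattice `(ℤ²², A)`. -/
theorem stmt8 :
    comp23ᵀ * gramA * comp23 = gramA ∧ comp23 ^ 23 = 1 ∧ comp23 ≠ 1 := by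
  refine ⟨by rw [Matrix.mul_assoc, gramA_mul_comp23]; decide +kernel, ?_, fun h => ?_⟩
  · rw [comp23_pow, ← pow_zero comp23, comp23_pow]
    simp
  · exact absurd (congrFun (congrFun h 0) 0) (by decide)
end

section
/- Let A be the 22×22 symmetric integer matrix with entries A_{ij} = c(|i−j|) for 1 ≤ i,j ≤ 22, where (c(0), c(1), …, c(21)) = (−2, 3, 0, 3, 0, 2, 1, 0, −1, −2, −2, −3, −3, −2, −2, −1, 0, 1, 2, 0, 3, 0). Then |det A| = 23, and the real quadratic form x ↦ xᵀAx on ℝ²² has signature (2,20): ℝ²² is the orthogonal direct sum (with respect to the bilinear form of A) of a 2-dimensional subspace on which the form is positive definite and a 20-dimensional subspace on which it is negative definite. -/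
open Matrix

/-- The real bilinear form `(x, y) ↦ xᵀ A y` on `ℝ²²`. -/
noncomputable def formA (x y : Fin 22 → ℝ) : ℝ :=
  x ⬝ᵥ (gramA.map ((↑) : ℤ → ℝ)).mulVec y

/-- A lower triangular integer matrix whose rows are an orthogonal basis for `gramA`. -/
def orthoRows : Matrix (Fin 22) (Fin 22) ℤ :=
  !![1, 0, 0, 0, 0, 0, 0, 0, 0, 0, 0, 0, 0, 0, 0, 0, 0, 0, 0, 0, 0, 0;
    3, 2, 0, 0, 0, 0, 0, 0, 0, 0, 0, 0, 0, 0, 0, 0, 0, 0, 0, 0, 0, 0;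
    -9, -6, 5, 0, 0, 0, 0, 0, 0, 0, 0, 0, 0, 0, 0, 0, 0, 0, 0, 0, 0, 0;
    -3, -9, -3, 7, 0, 0, 0, 0, 0, 0, 0, 0, 0, 0, 0, 0, 0, 0, 0, 0, 0, 0;
    -9, -3, -9, -3, 16, 0, 0, 0, 0, 0, 0, 0, 0, 0, 0, 0, 0, 0, 0, 0, 0, 0;
    -22, -24, 3, -24, 3, 50, 0, 0, 0, 0, 0, 0, 0, 0, 0, 0, 0, 0, 0, 0, 0, 0;
    -2, -111, -120, 15, -120, 16, 252, 0, 0, 0, 0, 0, 0, 0, 0, 0, 0, 0, 0, 0, 0, 0;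
    -472, -34, 1, -270, 255, -34, 36, 508, 0, 0, 0, 0, 0, 0, 0, 0, 0, 0, 0, 0, 0, 0;
    -289, -53, 17, -145, 135, 17, 17, 271, 35, 0, 0, 0, 0, 0, 0, 0, 0, 0, 0, 0, 0, 0;
    145, 8, -134, 136, 0, -80, 136, -154, -152, 135, 0, 0, 0, 0, 0, 0, 0, 0, 0, 0, 0, 0;
    705, 1784, -662, -1672, 2000, 0, -712, 1718, -2696, -1945, 2400, 0, 0, 0, 0, 0, 0, 0, 0, 0, 0, 0;
    134790, -40525, 22459, 31967, -202945, 194925, 112325, -163297, 130261, -162565, -149970, 233910, 0, 0, 0, 0, 0, 0, 0, 0, 0, 0;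
    236867, 140624, -252558, 180643, -95994, -326639, 620370, 38231, -321978, 305405, -393798, -188936, 507577, 0, 0, 0, 0, 0, 0, 0, 0, 0;
    162263, 341660, 112806, -331061, 203694, -150719, -356118, 948599, 34206, -488779, 437658, -623480, -244979, 861564, 0, 0, 0, 0, 0, 0, 0, 0;
    366719, 161383, 293985, 370972, -750058, 348047, 157008, -734615, 1488892, 142703, -941142, 764548, -875335, -332013, 1410551, 0, 0, 0, 0, 0, 0, 0;
    -32921, 119711, 69701, 71912, 135226, -232329, 71512, 65081, -227948, 446447, 61074, -295996, 226561, -271013, -109925, 430652, 0, 0, 0, 0, 0, 0;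
    549979, -190345, -164431, 395117, -268877, 283218, 217564, -182581, 181882, -254611, 380832, 265382, -357371, 432847, -258413, -208867, 653565, 0, 0, 0, 0, 0;
    262655, 1134107, -525411, -190215, 731451, -488834, 780296, 379519, -331270, 329441, -476456, 957254, 479689, -632685, 892551, -648807, -241555, 1447460, 0, 0, 0, 0;
    434351, 40025, 291111, 42771, -271335, 457267, 77855, 191272, 261428, -241309, 255004, 30056, 263359, 424971, -328095, 224667, 62399, -24655, 620031, 0, 0, 0;
    -31183, 95991, 5593, 52205, 25831, -80563, 86505, 15472, 28900, 69165, -65788, 46008, 2641, 34453, 106351, -73723, 34369, 11599, -27223, 135256, 0, 0;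
    24863, -11445, 21959, 7473, -2769, 24885, -10307, 18353, 11653, -6124, 27000, -8276, 12347, 16447, -7693, 26715, -5631, 8127, 20041, -11355, 27937, 0;
    893, 705, 149, 1203, 141, 735, 823, 83, 1183, 236, 600, 964, 17, 1117, 377, 465, 1059, -3, 1051, 495, 307, 1200]

/-- The values of the quadratic form of `gramA` on the rows of `orthoRows`. -/
def orthoDiag : Fin 22 → ℤ :=
  ![-2, 10, -140, -224, -800, -6300, -160020, -88900, 28350, -64800, -18712800,
    -118727336070, -437310070428, -1215279961764, -3037283046260, -281459074380,
    -189201838980, -897470071260, -83862912936, -3778646872, -33524400, -27600]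

theorem orthoRows_mul_gramA_mul_transpose :
    orthoRows * gramA * orthoRowsᵀ = diagonal orthoDiag := by
  decide +kernel

theorem det_orthoRows : orthoRows.det = ∏ i, orthoRows i i :=
  det_of_isLowerTriangular _ <| by
    have h : ∀ p : Fin 22 × Fin 22, p.1 < p.2 → orthoRows p.1 p.2 = 0 := by decide +kernel
    exact fun i j hij => h (i, j) hij

theorem det_orthoRows_ne_zero : orthoRows.det ≠ 0 := by
  rw [det_orthoRows]
  decide +kernel

theorem det_gramA : gramA.det = 23 := by
  have h := congrArg det orthoRows_mul_gramA_mul_transpose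
  rw [det_mul, det_mul, det_transpose, det_diagonal] at h
  have hd : ∏ i, orthoDiag i = orthoRows.det * 23 * orthoRows.det := by
    rw [det_orthoRows]
    decide +kernel
  rw [hd] at h
  exact mul_left_cancel₀ det_orthoRows_ne_zero (mul_right_cancel₀ det_orthoRows_ne_zero h)

/-- A basis that diagonalizes the bilinear form of a real matrix `M` splits the space into
orthogonal positive definite and negative definite subspaces of the expected dimensions. -/
theorem exists_orthogonal_splitting {n : Type*} [Fintype n] [DecidableEq n]
    {M P : Matrix n n ℝ} {d : n → ℝ} (hP : P.det ≠ 0) (h : P * M * Pᵀ = diagonal d)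
    (s : Finset n) (hpos : ∀ i ∈ s, 0 < d i) (hneg : ∀ i ∉ s, d i < 0) :
    ∃ Vpos Vneg : Submodule ℝ (n → ℝ),
      (∀ x ∈ Vpos, ∀ y ∈ Vneg, x ⬝ᵥ M *ᵥ y = 0) ∧
      Vpos ⊔ Vneg = ⊤ ∧ Vpos ⊓ Vneg = ⊥ ∧
      Module.finrank ℝ Vpos = s.card ∧ Module.finrank ℝ Vneg = sᶜ.card ∧
      (∀ x ∈ Vpos, x ≠ 0 → 0 < x ⬝ᵥ M *ᵥ x) ∧
      (∀ x ∈ Vneg, x ≠ 0 → x ⬝ᵥ M *ᵥ x < 0) := by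
  have hli : LinearIndependent ℝ P.row := linearIndependent_rows_of_det_ne_zero hP
  let b : Module.Basis n ℝ (n → ℝ) := basisOfLinearIndependentOfCardEqFinrank' P.row hli (by simp)
  have hb : ⇑b = P.row := coe_basisOfLinearIndependentOfCardEqFinrank' ..
  have hrepr (x : n → ℝ) : b.repr x ᵥ* P = x := by
    conv_rhs => rw [← b.sum_repr x, hb]
    ext j
    simp [vecMul, dotProduct]
  have hform (x y : n → ℝ) : x ⬝ᵥ M *ᵥ y = ∑ i, b.repr x i * (d i * b.repr y i) := by
    conv_lhs => rw [← hrepr x, ← hrepr y]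
    rw [← mulVec_transpose P (b.repr y), ← dotProduct_mulVec, mulVec_mulVec, mulVec_mulVec, h]
    simp [dotProduct, mulVec_diagonal]
  have hmem (t : Finset n) (x : n → ℝ) (hx : x ∈ Submodule.span ℝ (b '' t)) (i : n)
      (hi : i ∉ t) : b.repr x i = 0 := by
    by_contra hne
    exact hi (b.mem_span_image.1 hx (Finsupp.mem_support_iff.2 hne))
  have hexists (x : n → ℝ) (hx : x ≠ 0) : ∃ i, b.repr x i ≠ 0 := by
    by_contra! hz
    exact hx (b.repr.map_eq_zero_iff.1 (Finsupp.ext hz))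
  have hrank (t : Finset n) : Module.finrank ℝ (Submodule.span ℝ (b '' t)) = t.card := by
    classical
    rw [← Finset.coe_image, finrank_span_finset_eq_card, Finset.card_image_of_injective _ b.injective]
    rw [Finset.coe_image]
    exact (b.linearIndependent.linearIndepOn _).id_image
  refine ⟨.span ℝ (b '' s), .span ℝ (b '' ↑sᶜ), ?_, ?_, ?_, hrank s, hrank sᶜ, ?_, ?_⟩
  · intro x hx y hy
    rw [hform]
    refine Finset.sum_eq_zero fun i _ => ?_
    by_cases hi : i ∈ s
    · simp [hmem _ y hy i (by simpa using hi)]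
    · simp [hmem _ x hx i hi]
  · rw [← Submodule.span_union, ← Set.image_union]
    simp
  · rw [← disjoint_iff]
    refine b.linearIndependent.disjoint_span_image ?_
    simpa using disjoint_compl_right
  · intro x hx hx0
    obtain ⟨j, hj⟩ := hexists x hx0
    have hjs : j ∈ s := by_contra fun hn => hj (hmem _ x hx j hn)
    rw [hform]
    refine Finset.sum_pos' (fun i _ => ?_) ⟨j, Finset.mem_univ j, ?_⟩
    · by_cases hi : i ∈ s
      · nlinarith [mul_nonneg (hpos i hi).le (mul_self_nonneg (b.repr x i))]
      · simp [hmem _ x hx i hi]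
    · nlinarith [mul_pos (hpos j hjs) (mul_self_pos.2 hj)]
  · intro x hx hx0
    obtain ⟨j, hj⟩ := hexists x hx0
    have hjs : j ∉ s := fun hn => hj (hmem _ x hx j (by simpa using hn))
    rw [hform]
    refine Finset.sum_neg' (fun i _ => ?_) ⟨j, Finset.mem_univ j, ?_⟩
    · by_cases hi : i ∈ s
      · simp [hmem _ x hx i (by simpa using hi)]
      · nlinarith [mul_nonneg (neg_nonneg.2 (hneg i hi).le) (mul_self_nonneg (b.repr x i))]
    · nlinarith [mul_pos (neg_pos.2 (hneg j hjs)) (mul_self_pos.2 hj)]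

/-- The Gram matrix `A` from the appendix has `|det A| = 23`, and the
associated real quadratic form on `ℝ²²` has signature `(2, 20)`. -/
theorem stmt9 :
    |gramA.det| = 23 ∧
      ∃ Vpos Vneg : Submodule ℝ (Fin 22 → ℝ),
        (∀ x ∈ Vpos, ∀ y ∈ Vneg, formA x y = 0) ∧
        Vpos ⊔ Vneg = ⊤ ∧ Vpos ⊓ Vneg = ⊥ ∧
        Module.finrank ℝ Vpos = 2 ∧ Module.finrank ℝ Vneg = 20 ∧
        (∀ x ∈ Vpos, x ≠ 0 → 0 < formA x x) ∧
        (∀ x ∈ Vneg, x ≠ 0 → formA x x < 0) := by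
  refine ⟨by simp [det_gramA], ?_⟩
  have hP : (orthoRows.map ((↑) : ℤ → ℝ)).det ≠ 0 := by
    have h := (Int.castRingHom ℝ).map_det orthoRows
    simp only [eq_intCast, RingHom.mapMatrix_apply, Int.coe_castRingHom] at h
    rw [← h]
    exact_mod_cast det_orthoRows_ne_zero
  have hdiag : orthoRows.map ((↑) : ℤ → ℝ) * gramA.map ((↑) : ℤ → ℝ) *
      (orthoRows.map ((↑) : ℤ → ℝ))ᵀ = diagonal fun i => (orthoDiag i : ℝ) := by
    have h := congrArg (Int.castRingHom ℝ).mapMatrix orthoRows_mul_gramA_mul_transpose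
    simp only [map_mul, RingHom.mapMatrix_apply, transpose_map, diagonal_map (map_zero _)] at h
    exact h
  have hpos : ∀ i ∈ ({1, 8} : Finset (Fin 22)), 0 < orthoDiag i := by decide +kernel
  have hneg : ∀ i ∉ ({1, 8} : Finset (Fin 22)), orthoDiag i < 0 := by decide +kernel
  exact exists_orthogonal_splitting hP hdiag {1, 8}
    (fun i hi => Int.cast_pos.2 (hpos i hi)) (fun i hi => Int.cast_lt_zero.2 (hneg i hi))
end

section
/- Let A be the 22×22 symmetric integer matrix with entries A_{ij} = c(|i−j|), where (c(0), …, c(21)) = (−2, 3, 0, 3, 0, 2, 1, 0, −1, −2, −2, −3, −3, −2, −2, −1, 0, 1, 2, 0, 3, 0), and let C be the companion matrix of Φ₂₃(X) = X²² + X²¹ + ⋯ + 1. Then the isometry C acts trivially on the discriminant group of the lattice (ℤ²², A): every entry of the integer matrix (C − I)·adjugate(A) is divisible by 23 (equivalently, (C − I)·A⁻¹ maps ℤ²² into ℤ²², i.e. C fixes the dual lattice A⁻¹ℤ²² modulo ℤ²²). -/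
open Matrix

/-- The function on `ℤ/23` whose differences give the entries of
`23 * (comp23 - 1) * gramA⁻¹`. -/
def quotientCoeff (n : ℕ) : ℤ :=
  [0, -1200, -307, -495, -1051, 3, -1059, -465, -377, -1117, -17, -964,
    -600, -236, -1183, -83, -823, -735, -141, -1203, -149, -705, -893].getD (n % 23) 0

/-- The integer matrix `(comp23 - 1) * gramA⁻¹`. -/
def quotientMatrix : Matrix (Fin 22) (Fin 22) ℤ :=
  Matrix.of fun i j : Fin 22 =>
    (quotientCoeff (i + 23 - j) - quotientCoeff (i + 1) - quotientCoeff (22 - j)) / 23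

theorem quotientMatrix_mul_gramA : quotientMatrix * gramA = comp23 - 1 := by
  have h : ∀ i j : Fin 22, ∑ k, quotientMatrix i k * gramA k j =
      comp23 i j - if i = j then 1 else 0 := by
    decide +kernel
  ext i j
  rw [Matrix.mul_apply, Matrix.sub_apply, Matrix.one_apply, h]

/-- If `M *ᵥ v = k • w` and some entry of `v` is `1`, then `k` divides `det M`. -/
theorem dvd_det_of_mulVec_eq_smul {n R : Type*} [Fintype n] [DecidableEq n] [CommRing R]
    {M : Matrix n n R} {v w : n → R} {k : R} {i : n} (h : M *ᵥ v = k • w) (hi : v i = 1) :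
    k ∣ M.det := by
  have h' : M.det • v = k • (M.adjugate *ᵥ w) := by
    rw [← Matrix.mulVec_smul, ← h, Matrix.mulVec_mulVec, Matrix.adjugate_mul,
      Matrix.smul_mulVec, Matrix.one_mulVec]
  exact ⟨(M.adjugate *ᵥ w) i, by simpa [hi] using congrFun h' i⟩

theorem dvd_det_gramA : (23 : ℤ) ∣ gramA.det := by
  have h : ∀ i, (23 : ℤ) ∣ (gramA *ᵥ fun j => (j : ℤ) + 1) i := by decide +kernel
  choose w hw using h
  exact dvd_det_of_mulVec_eq_smul (i := 0) (funext hw) (by simp)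

/-- The isometry given by the companion matrix `C` of `Φ₂₃` acts
trivially on the discriminant group of the lattice `(ℤ²², A)`: every entry of
`(C - 1) * adjugate A` is divisible by `23`. -/
theorem stmt11 :
    ∀ i j : Fin 22, (23 : ℤ) ∣ ((comp23 - 1) * gramA.adjugate) i j := by
  intro i j
  rw [← quotientMatrix_mul_gramA, Matrix.mul_assoc, Matrix.mul_adjugate, Matrix.mul_smul,
    Matrix.mul_one, Matrix.smul_apply, smul_eq_mul]
  exact dvd_mul_of_dvd_left dvd_det_gramA _
end

section
/- The lattice S = U ⊕ U ⊕ E8 ⊕ E8 ⊕ K₂₃, with Gram matrix G of rank 22, admits an isometry of order 23 acting trivially on its discriminant group: there exists a 22×22 integer matrix M with Mᵀ·G·M = G, M²³ = I, M ≠ I, and (M − I)·G⁻¹·y ∈ ℤ²² for every y ∈ ℤ²². -/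
open Matrix

/-- Gram matrix of the negative definite `E8` lattice (diagonal `-2`, entry `1` for
vertices adjacent in the `E8` Dynkin diagram). -/
def latE8 : Matrix (Fin 8) (Fin 8) ℤ :=
  !![-2,  0,  1,  0,  0,  0,  0,  0;
      0, -2,  0,  1,  0,  0,  0,  0;
      1,  0, -2,  1,  0,  0,  0,  0;
      0,  1,  1, -2,  1,  0,  0,  0;
      0,  0,  0,  1, -2,  1,  0,  0;
      0,  0,  0,  0,  1, -2,  1,  0;
      0,  0,  0,  0,  0,  1, -2,  1;
      0,  0,  0,  0,  0,  0,  1, -2]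

/-- Gram matrix of the lattice `K₂₃`. -/
def latK23 : Matrix (Fin 2) (Fin 2) ℤ := !![-12, 1; 1, -2]

/-- Gram matrix of the lattice `S = U ⊕ U ⊕ E8 ⊕ E8 ⊕ K₂₃` of signature `(2, 20)`. -/
def gramS : Matrix (Fin 22) (Fin 22) ℤ :=
  Matrix.reindex
    (((((finSumFinEquiv.sumCongr (Equiv.refl (Fin 8))).trans
          finSumFinEquiv).sumCongr (Equiv.refl (Fin 8))).trans
          finSumFinEquiv).sumCongr (Equiv.refl (Fin 2)) |>.trans finSumFinEquiv)
    (((((finSumFinEquiv.sumCongr (Equiv.refl (Fin 8))).trans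
          finSumFinEquiv).sumCongr (Equiv.refl (Fin 8))).trans
          finSumFinEquiv).sumCongr (Equiv.refl (Fin 2)) |>.trans finSumFinEquiv)
    (Matrix.fromBlocks
      (Matrix.fromBlocks
        (Matrix.fromBlocks (Matrix.fromBlocks latU 0 0 latU) 0 0 latE8) 0 0 latE8)
      0 0 latK23)

/-- The inverse of the Gram matrix `latE8`. -/
def latE8Inv : Matrix (Fin 8) (Fin 8) ℤ :=
  !![ -4,  -5,  -7, -10,  -8,  -6,  -4,  -2;
      -5,  -8, -10, -15, -12,  -9,  -6,  -3;
      -7, -10, -14, -20, -16, -12,  -8,  -4;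
     -10, -15, -20, -30, -24, -18, -12,  -6;
      -8, -12, -16, -24, -20, -15, -10,  -5;
      -6,  -9, -12, -18, -15, -12,  -8,  -4;
      -4,  -6,  -8, -12, -10,  -8,  -6,  -3;
      -2,  -3,  -4,  -6,  -5,  -4,  -3,  -2]

/-- The coefficients, modulo `x ^ 23 - 1`, of a real element of `ℤ[ζ₂₃]` generating the square of
the prime above `23`; it is positive at exactly one real place of `ℚ(ζ₂₃)⁺`. -/
def cyclotomicKernel : Fin 23 → ℤ :=
  ![-2, 1, 0, 0, 0, 0, -1, 0, 0, 0, 1, 0, 0, 1, 0, 0, 0, -1, 0, 0, 0, 0, 1]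

/-- The Gram matrix, in the basis `1, ζ, …, ζ ^ 21` of `ℤ[ζ₂₃]`, of the trace form
`(x, y) ↦ Tr (a * x * conj y) / 23` with `a` given by `cyclotomicKernel`. -/
def cyclotomicGram : Matrix (Fin 22) (Fin 22) ℤ :=
  of fun i j => cyclotomicKernel (i.castSucc - j.castSucc)

/-- The matrix of multiplication by `ζ ^ k` in the basis `1, ζ, …, ζ ^ 21` of `ℤ[ζ₂₃]`. -/
def zetaPow (k : ℕ) : Matrix (Fin 22) (Fin 22) ℤ :=
  of fun i j =>
    if (j + k) % 23 = 22 then -1 else if (i : ℕ) = (j + k) % 23 then 1 else 0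

/-- An integer matrix `W` with `W * cyclotomicGram = zetaPow 1 - 1`. -/
def cyclotomicQuot : Matrix (Fin 22) (Fin 22) ℤ :=
  !![ 36,  84,  69,  15,   7,  59,  87,  47,   3,  24,  78,  78,  24,   3,  47,  87,  59,   7,  15,  69,  84,  36;
       0,  84, 117,  48, -14,  30, 110,  98,  14,  -9,  66, 120,  66,  -9,  14,  98, 110,  30, -14,  48, 117,  84;
     -48,   0,  69,  48, -29, -39,  33,  73,  17, -46, -15,  60,  60, -15, -46,  17,  73,  33, -39, -29,  48,  69;
     -33, -33,   0,  15, -14, -39, -21,  11,   7, -28, -37,  -6,  15,  -6, -37, -28,   7,  11, -21, -39, -14,  15;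
      21,  36,  21,   0,   7,  30,  33,  11,  -1,  16,  35,  26,   3,   3,  26,  35,  16,  -1,  11,  33,  30,   7;
      29,  98,  98,  29,   0,  59, 110,  73,   7,  16,  87, 106,  43,  -1,  43, 106,  87,  16,   7,  73, 110,  59;
     -23,  54, 108,  54, -23,   0,  87,  98,  17, -28,  35, 106,  71, -13, -13,  71, 106,  35, -28,  17,  98,  87;
     -51, -26,  36,  36, -26, -51,   0,  47,  14, -46, -37,  26,  43, -13, -53, -13,  43,  26, -37, -46,  14,  47;
     -11, -14,  -4,   4,  -4, -14, -11,   0,   3,  -9, -15,  -6,   3,  -1, -13, -13,  -1,   3,  -6, -15,  -9,   3;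
      33,  70,  52,   8,   8,  52,  70,  33,   0,  24,  66,  60,  15,   3,  43,  71,  43,   3,  15,  60,  66,  24;
      12,  93, 115,  43,  -9,  43, 115,  93,  12,   0,  78, 120,  60,  -6,  26, 106, 106,  26,  -6,  60, 120,  78;
     -42,  18,  84,  52, -28, -28,  52,  84,  18, -42,   0,  78,  66, -15, -37,  35,  87,  35, -37, -15,  66,  78;
     -42, -36,   9,  21, -19, -47, -19,  21,   9, -36, -42,   0,  24,  -9, -46, -28,  16,  16, -28, -46,  -9,  24;
      12,  18,   9,   0,   4,  16,  16,   4,   0,   9,  18,  12,   0,   3,  14,  17,   7,  -1,   7,  17,  14,   3;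
      33,  93,  84,  21,   4,  60, 100,  60,   4,  21,  84,  93,  33,   0,  47,  98,  73,  11,  11,  73,  98,  47;
     -11,  70, 115,  52, -19,  16, 100, 100,  16, -19,  52, 115,  70, -11,   0,  87, 110,  33, -21,  33, 110,  87;
     -51, -14,  52,  43, -28, -47,  16,  60,  16, -47, -28,  43,  52, -14, -51,   0,  59,  30, -39, -39,  30,  59;
     -23, -26,  -4,   8,  -9, -28, -19,   4,   4, -19, -28,  -9,   8,  -4, -26, -23,   0,   7, -14, -29, -14,   7;
      29,  54,  36,   4,   8,  43,  52,  21,   0,  21,  52,  43,   8,   4,  36,  54,  29,   0,  15,  48,  48,  15;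
      21,  98, 108,  36,  -4,  52, 115,  84,   9,   9,  84, 115,  52,  -4,  36, 108,  98,  21,   0,  69, 117,  69;
     -33,  36,  98,  54, -26, -14,  70,  93,  18, -36,  18,  93,  70, -14, -26,  54,  98,  36, -33,   0,  84,  84;
     -48, -33,  21,  29, -23, -51, -11,  33,  12, -42, -42,  12,  33, -11, -51, -23,  29,  21, -33, -48,   0,  36]

/-- The columns are a basis of `ℤ[ζ₂₃]` in which `cyclotomicGram` becomes `gramS`. -/
def basisChange : Matrix (Fin 22) (Fin 22) ℤ :=
  !![    2,     0,    36,   224,     0,     0,     0,     0,     0,     0,     0,     0,     1,    -1,    -4,     4,     0,     1,     3,     2,  -340,   137;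
         3,    -1,   260,  1696,     0,     0,     0,     0,     0,     0,     0,     0,     9,     7,     0,     3,    10,     8,     8,     5, -2490,  1019;
         2,    -2,   309,  2030,     0,     0,     0,     0,     0,     0,     0,     0,    12,    12,     5,    -2,    14,     9,     8,     4, -2964,  1217;
         5,     3,   329,  2154,     0,     0,     1,     0,     0,     0,     0,     0,     8,    15,    12,    -2,    12,     5,    10,     5, -3148,  1295;
         8,     7,   372,  2415,     0,     0,     1,     1,     0,    -1,     0,     0,     6,    15,    13,     2,    10,     4,    14,     7, -3547,  1458;
         3,     0,   154,   994,     0,     0,     0,     0,     0,     0,     0,     0,     5,     3,    -2,     4,     5,     4,     6,     4, -1469,   600;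
         0,    -6,   375,  2459,     0,     0,     0,     0,     0,     0,    -1,    -1,    15,     9,     5,     1,    15,    13,     9,     7, -3593,  1476;
        -7,   -12,   138,   927,     1,    -1,    -1,     0,     0,     0,    -1,    -1,    11,     0,     2,    -3,     8,    11,    -1,     2, -1332,   551;
        -5,    -7,   -45,  -283,     0,    -1,     0,     0,     0,     0,    -1,     0,     2,    -5,    -1,    -1,    -1,     3,    -4,     0,   426,  -173;
        -5,    -6,  -250, -1636,     0,     0,     0,    -1,     0,     0,     0,     0,    -4,   -14,   -13,     3,    -9,    -1,    -8,    -3,  2389,  -985;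
         0,    -3,    20,   127,     0,     0,     0,    -1,     0,     1,     0,     0,     4,    -2,    -9,     3,     2,     4,     1,     1,  -195,    75;
         1,    -3,   258,  1697,     0,     0,     0,    -1,     1,     0,     0,     0,    11,     9,     2,    -1,    12,     9,     6,     4, -2478,  1016;
         1,    -1,   237,  1559,     0,     0,     0,     0,     0,     0,     0,     0,     8,    10,     8,    -3,    10,     6,     6,     3, -2272,   935;
         5,     5,    95,   611,    -1,     0,     1,     0,     0,     0,     1,     0,     0,     6,     3,     1,     2,    -1,     5,     2,  -904,   370;
         2,     0,    88,   564,     0,     0,     0,     0,     0,     0,     0,     0,     3,     0,    -3,     4,     2,     3,     4,     3,  -839,   341;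
         3,    -1,   326,  2130,     0,     0,     0,     0,     0,     0,     0,     0,    12,    10,     2,     2,    13,     9,    10,     6, -3121,  1280;
         8,     3,   733,  4796,     0,     0,     1,     1,     0,    -1,     0,    -1,    20,    28,    23,    -2,    27,    14,    22,    12, -7012,  2884;
         0,    -1,    92,   608,     0,     0,     0,     0,     0,     0,     0,     0,     3,     4,     4,    -2,     4,     3,     2,     1,  -883,   364;
        -4,    -6,  -108,  -707,     0,    -1,     0,     0,     0,     0,    -1,     0,    -1,    -9,    -6,     2,    -4,     1,    -4,     0,  1034,  -425;
         3,     0,   180,  1168,     0,     0,     0,     0,     0,     0,     0,     0,     6,     4,    -2,     4,     6,     5,     7,     4, -1722,   703;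
         3,    -2,   391,  2561,     0,     0,     0,     0,     0,     0,     0,     0,    14,    13,     6,     0,    16,    11,    11,     6, -3745,  1538;
         1,    -2,   245,  1614,     0,     0,     0,     0,     0,     0,     0,     0,     9,    10,     7,    -3,    11,     7,     5,     4, -2351,   967]

/-- The inverse of `basisChange`. -/
def basisChangeInv : Matrix (Fin 22) (Fin 22) ℤ :=
  !![    8,    15,    11,    15,    -7,    -3,     4,     4,   -10,     0,   -15,     0,    14,     4,    19,    11,    -8,    -3,     6,   -23,   -16,   -14;
         4,    12,    10,    15,    -7,     0,     4,     4,    -9,     0,   -15,     0,    10,     4,    17,    13,    -8,     2,     5,   -19,   -16,   -14;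
     -1081,   903,  2594,  4619, -2251,  2612,  1184,  1184, -1830,     0, -4619,     0,  -532,  1184,  3446,  4146, -2368,  4294,   646, -2300, -4004, -3798;
      -164,   141,   399,   710,  -346,   399,   182,   182,  -282,     0,  -710,     0,   -79,   182,   531,   637,  -364,   657,   100,  -356,  -616,  -584;
        -9,   -21,   -16,   -23,    11,     2,    -7,    -6,    15,     0,    24,     0,   -20,    -7,   -27,   -19,    13,     1,    -9,    32,    25,    22;
       -14,   -33,   -24,   -35,    16,     4,    -9,   -10,    23,     0,    35,     0,   -31,   -10,   -41,   -28,    19,     4,   -14,    49,    38,    33;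
       -19,   -43,   -32,   -47,    22,     4,   -13,   -13,    31,     0,    48,     0,   -41,   -13,   -55,   -38,    26,     3,   -18,    65,    51,    44;
       -28,   -64,   -47,   -70,    32,     7,   -19,   -19,    46,    -1,    70,     0,   -61,   -19,   -81,   -56,    38,     6,   -27,    97,    75,    65;
       -24,   -53,   -38,   -55,    25,     8,   -15,   -15,    37,    -1,    55,     1,   -51,   -15,   -65,   -44,    30,     8,   -22,    79,    60,    51;
       -20,   -41,   -29,   -40,    18,     8,   -11,   -11,    28,    -1,    41,     0,   -40,   -11,   -49,   -32,    22,     9,   -17,    61,    45,    38;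
       -15,   -29,   -20,   -27,    12,     7,    -8,    -7,    19,     0,    27,     0,   -29,    -7,   -34,   -21,    15,     8,   -12,    43,    31,    26;
        -8,   -15,   -10,   -13,     6,     4,    -4,    -4,    10,     0,    13,     0,   -15,    -4,   -17,   -10,     7,     5,    -6,    22,    16,    13;
       179,  -137,  -412,  -737,   359,  -422,  -189,  -189,   291,     0,   737,     0,    94,  -189,  -545,  -662,   378,  -694,  -102,   357,   636,   604;
       258,  -212,  -615, -1096,   534,  -619,  -281,  -281,   435,     0,  1096,     0,   128,  -281,  -818,  -983,   562, -1019,  -154,   543,   948,   900;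
       351,  -275,  -819, -1462,   712,  -833,  -375,  -375,   578,     0,  1462,     0,   181,  -375, -1085, -1313,   750, -1370,  -203,   714,  1263,  1199;
       516,  -409, -1211, -2160,  1052, -1228,  -554,  -554,   855,     0,  2160,     0,   263,  -554, -1606, -1939,  1108, -2020,  -301,  1059,  1867,  1772;
       423,  -331,  -987, -1762,   858, -1004,  -452,  -452,   696,     0,  1762,     0,   218,  -452, -1308, -1582,   904, -1651,  -244,   860,  1522,  1445;
       325,  -249,  -751, -1342,   654,  -768,  -344,  -344,   529,     0,  1342,     0,   170,  -344,  -994, -1205,   688, -1261,  -185,   651,  1158,  1100;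
       220,  -173,  -513,  -916,   446,  -522,  -235,  -235,   362,     0,   916,     0,   113,  -235,  -680,  -822,   470,  -857,  -127,   448,   791,   751;
       112,   -87,  -260,  -464,   226,  -265,  -119,  -119,   183,     0,   464,     0,    58,  -119,  -344,  -416,   238,  -435,   -64,   226,   400,   381;
      -108,    93,   263,   468,  -228,   263,   120,   120,  -186,     0,  -468,     0,   -52,   120,   350,   420,  -240,   433,    66,  -235,  -406,  -385;
       271,  -227,  -651, -1159,   565,  -655,  -297,  -297,   459,     0,  1159,     0,   133,  -297,  -865, -1040,   594, -1077,  -162,   577,  1005,   953]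

lemma latE8_mul_latE8Inv : latE8 * latE8Inv = 1 := by
  decide +kernel

lemma zetaPow_one_castSucc (i : Fin 22) (l : Fin 21) :
    zetaPow 1 i l.castSucc = if i = l.succ then 1 else 0 := by
  revert i l
  decide +kernel

lemma zetaPow_one_last (i : Fin 22) : zetaPow 1 i (Fin.last 21) = -1 := rfl

lemma zetaPow_one_mul (k : ℕ) : zetaPow 1 * zetaPow k = zetaPow (k + 1) := by
  ext i j
  rw [mul_apply, Fin.sum_univ_castSucc]
  simp only [zetaPow_one_castSucc, zetaPow_one_last]
  cases i using Fin.cases with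
  | zero =>
    simp [zetaPow, (Fin.succ_ne_zero _).symm]
    split_ifs <;> lia
  | succ i =>
    simp only [Fin.succ_inj, ite_mul, one_mul, zero_mul, Finset.sum_ite_eq, Finset.mem_univ,
      if_true]
    simp [zetaPow]
    split_ifs <;> lia

lemma zetaPow_one_pow (k : ℕ) : zetaPow 1 ^ k = zetaPow k := by
  induction k with
  | zero => decide +kernel
  | succ k ih => rw [pow_succ', ih, zetaPow_one_mul]

lemma zetaPow_one_pow_23 : zetaPow 1 ^ 23 = 1 := by
  rw [zetaPow_one_pow]
  decide +kernel

lemma zetaPow_one_isometry :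
    (zetaPow 1)ᵀ * cyclotomicGram * zetaPow 1 = cyclotomicGram := by
  decide +kernel

lemma cyclotomicQuot_mul_gram : cyclotomicQuot * cyclotomicGram = zetaPow 1 - 1 := by
  decide +kernel

lemma basisChangeInv_mul_basisChange : basisChangeInv * basisChange = 1 := by
  decide +kernel

lemma basisChange_mul_basisChangeInv : basisChange * basisChangeInv = 1 :=
  mul_eq_one_comm.mp basisChangeInv_mul_basisChange

lemma basisChange_transpose_mul_gram :
    basisChangeᵀ * cyclotomicGram = gramS * basisChangeInv := by
  decide +kernel

lemma gram_mul_basisChange :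
    cyclotomicGram * basisChange = basisChangeInvᵀ * gramS := by
  have h : basisChangeInvᵀ * basisChangeᵀ = 1 := by
    rw [← transpose_mul, basisChange_mul_basisChangeInv, transpose_one]
  calc cyclotomicGram * basisChange
      = basisChangeInvᵀ * basisChangeᵀ * cyclotomicGram * basisChange := by rw [h, one_mul]
    _ = basisChangeInvᵀ * (basisChangeᵀ * cyclotomicGram) * basisChange := by
        simp only [mul_assoc]
    _ = basisChangeInvᵀ * gramS * (basisChangeInv * basisChange) := by
        rw [basisChange_transpose_mul_gram]
        simp only [mul_assoc]
    _ = basisChangeInvᵀ * gramS := by rw [basisChangeInv_mul_basisChange, mul_one]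

lemma gramS_det_ne_zero : gramS.det ≠ 0 := by
  have hE : latE8.det ≠ 0 := fun h => by
    simpa [h] using congrArg det latE8_mul_latE8Inv
  have hU : latU.det ≠ 0 := by simp [latU, det_fin_two]
  have hK : latK23.det ≠ 0 := by simp [latK23, det_fin_two]
  rw [gramS, det_reindex_self]
  simp only [det_fromBlocks_zero₂₁]
  exact mul_ne_zero (mul_ne_zero (mul_ne_zero (mul_ne_zero hU hU) hE) hE) hK

/-- If `A = Z * G` with `Z` integral and `G` nondegenerate, then `A * G⁻¹` preserves integral
vectors. -/
lemma exists_int_mulVec_of_eq_mul {n : Type*} [Fintype n] [DecidableEq n] {A Z G : Matrix n n ℤ}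
    (hG : G.det ≠ 0) (hA : A = Z * G) (y : n → ℤ) :
    ∃ z : n → ℤ, (A.map ((↑) : ℤ → ℚ) * (G.map ((↑) : ℤ → ℚ))⁻¹).mulVec (fun k => (y k : ℚ)) =
      fun k => (z k : ℚ) := by
  have hdet : IsUnit (G.map ((↑) : ℤ → ℚ)).det := by
    have h : (G.map ((↑) : ℤ → ℚ)).det = (G.det : ℚ) := ((Int.castRingHom ℚ).map_det G).symm
    rw [h]
    exact (Int.cast_ne_zero.mpr hG).isUnit
  have hmap : A.map ((↑) : ℤ → ℚ) = Z.map ((↑) : ℤ → ℚ) * G.map ((↑) : ℤ → ℚ) := by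
    rw [hA]
    exact Matrix.map_mul (f := Int.castRingHom ℚ)
  refine ⟨Z.mulVec y, ?_⟩
  rw [hmap, mul_nonsing_inv_cancel_right _ _ hdet]
  ext i
  simp [mulVec, dotProduct]

/-- The lattice `S = U ⊕ U ⊕ E8 ⊕ E8 ⊕ K₂₃` admits an isometry of
order `23` acting trivially on its discriminant group: `(M - 1) * G⁻¹` maps `ℤ²²` into
`ℤ²²`. -/
theorem stmt12 :
    ∃ M : Matrix (Fin 22) (Fin 22) ℤ,
      Mᵀ * gramS * M = gramS ∧ M ^ 23 = 1 ∧ M ≠ 1 ∧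
      ∀ y : Fin 22 → ℤ, ∃ z : Fin 22 → ℤ,
        (((M - 1).map ((↑) : ℤ → ℚ)) * (gramS.map ((↑) : ℤ → ℚ))⁻¹).mulVec
            (fun k => (y k : ℚ)) = fun k => (z k : ℚ) := by
  have hPQ := basisChange_mul_basisChangeInv
  have hQP := basisChangeInv_mul_basisChange
  have hGP := gram_mul_basisChange
  refine ⟨basisChangeInv * zetaPow 1 * basisChange, ?_, ?_, ?_, ?_⟩
  · calc (basisChangeInv * zetaPow 1 * basisChange)ᵀ * gramS *
          (basisChangeInv * zetaPow 1 * basisChange)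
        = basisChangeᵀ * (zetaPow 1)ᵀ * (basisChangeInvᵀ * gramS) * basisChangeInv *
            zetaPow 1 * basisChange := by
          simp only [transpose_mul, mul_assoc]
      _ = basisChangeᵀ * (zetaPow 1)ᵀ * cyclotomicGram * (basisChange * basisChangeInv) *
            zetaPow 1 * basisChange := by
          rw [← hGP]
          simp only [mul_assoc]
      _ = basisChangeᵀ * ((zetaPow 1)ᵀ * cyclotomicGram * zetaPow 1) * basisChange := by
          rw [hPQ, mul_one]
          simp only [mul_assoc]
      _ = gramS := by
          rw [zetaPow_one_isometry, basisChange_transpose_mul_gram, mul_assoc, hQP, mul_one]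
  · let u : (Matrix (Fin 22) (Fin 22) ℤ)ˣ := ⟨basisChangeInv, basisChange, hQP, hPQ⟩
    have h := Units.conj_pow u (zetaPow 1) 23
    rw [zetaPow_one_pow_23, mul_one, Units.mul_inv] at h
    exact h
  · intro h
    have hz : zetaPow 1 = 1 := by
      calc zetaPow 1 = basisChange * basisChangeInv * zetaPow 1 *
            (basisChange * basisChangeInv) := by rw [hPQ, one_mul, mul_one]
        _ = basisChange * (basisChangeInv * zetaPow 1 * basisChange) * basisChangeInv := by
            simp only [mul_assoc]
        _ = 1 := by rw [h, mul_one, hPQ]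
    exact absurd (congrFun (congrFun hz 0) 0) (by decide)
  · refine exists_int_mulVec_of_eq_mul (Z := basisChangeInv * cyclotomicQuot * basisChangeInvᵀ)
      gramS_det_ne_zero ?_
    rw [mul_assoc _ _ gramS, ← hGP, ← mul_assoc, mul_assoc basisChangeInv cyclotomicQuot,
      cyclotomicQuot_mul_gram, mul_sub, sub_mul, mul_one, hQP]
end

section
/- The lattice L = E8 ⊕ E8 ⊕ U ⊕ U ⊕ U ⊕ ⟨−2⟩, with Gram matrix G_L of rank 23, admits an isometry of order 23 whose invariant sublattice is isometric to ⟨46⟩ and whose co-invariant sublattice is isometric to U ⊕ U ⊕ E8 ⊕ E8 ⊕ K₂₃: there exists a 23×23 integer matrix M with Mᵀ·G_L·M = G_L, M²³ = I, M ≠ I, such that the fixed submodule T = {x ∈ ℤ²³ : M·x = x} is free of rank 1 generated by a vector t with tᵀ·G_L·t = 46, and the orthogonal complement {x ∈ ℤ²³ : tᵀ·G_L·x = 0}, with the form restricted from G_L, is isometric to the lattice U ⊕ U ⊕ E8 ⊕ E8 ⊕ K₂₃. -/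
open Matrix

/-- Reindexing equivalence used to assemble the Gram matrix of `L`. -/
def eqL : (((((Fin 8 ⊕ Fin 8) ⊕ Fin 2) ⊕ Fin 2) ⊕ Fin 2) ⊕ Fin 1) ≃ Fin 23 :=
  (Equiv.sumCongr
    ((Equiv.sumCongr
      ((Equiv.sumCongr
        ((Equiv.sumCongr finSumFinEquiv (Equiv.refl (Fin 2))).trans finSumFinEquiv)
        (Equiv.refl (Fin 2))).trans finSumFinEquiv)
      (Equiv.refl (Fin 2))).trans finSumFinEquiv)
    (Equiv.refl (Fin 1))).trans finSumFinEquiv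

/-- Gram matrix of the lattice `L = E8 ⊕ E8 ⊕ U ⊕ U ⊕ U ⊕ ⟨-2⟩` of signature `(3, 20)`. -/
def gramL : Matrix (Fin 23) (Fin 23) ℤ :=
  Matrix.reindex eqL eqL
    (Matrix.fromBlocks
      (Matrix.fromBlocks
        (Matrix.fromBlocks
          (Matrix.fromBlocks (Matrix.fromBlocks latE8 0 0 latE8) 0 0 latU) 0 0 latU)
        0 0 latU)
      0 0 !![-2])

/-- The columns form a basis of `L` in which the Gram matrix is circulant. -/
def cyclicBasis : Matrix (Fin 23) (Fin 23) ℤ :=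
  !![0, -2, -1, 1, 0, 0, 2, 1, 0, -1, -1, -2, 0, 1, 0, 1, 0, -1, -1, 1, 0, 0, 2;
     0, 0, 0, 1, 0, -1, 0, -1, 0, 0, -2, -3, 2, 3, 0, 1, 2, 1, -2, 1, -1, -1, 0;
     -1, -1, 0, 1, 0, 0, 1, -1, 0, 0, -2, -3, 2, 3, 0, 1, 1, 0, -2, 1, -1, 0, 1;
     -1, -2, 1, 0, -2, 0, 3, 0, 1, 1, 0, -2, 1, 1, 0, 1, 0, -2, -1, 0, -3, 1, 3;
     -1, -1, 1, 0, -1, 0, 2, 0, 1, 0, -1, -2, 1, 1, 0, 1, 0, -1, -1, 0, -2, 1, 2;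
     -1, -1, 1, 0, -1, 0, 2, 0, 0, 0, 0, -1, 1, 1, 0, 0, 0, -1, -1, 0, -1, 1, 1;
     0, 0, 0, 0, 0, 0, 1, 0, 0, 0, -1, -2, 1, 2, 0, 0, 1, 0, -2, 0, 0, 0, 0;
     0, 0, 0, 0, 0, 0, 1, 0, 0, 0, 0, -1, 0, 1, 0, 0, 0, 0, -1, 0, 0, 0, 0;
     0, 0, 1, 0, -1, 0, 0, 0, 0, 1, 0, 1, 0, 0, -1, 0, 0, 0, 0, 0, -1, 0, 0;
     0, 1, 1, 0, -1, 0, -1, 0, 0, 1, 0, 2, 0, 0, -1, 0, 0, 0, 0, 0, -1, 0, -1;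
     0, 1, 2, 0, -2, 0, -1, 0, 0, 2, 0, 2, 0, 0, -1, 0, 0, 0, 0, 0, -2, 0, -1;
     0, 1, 0, 1, -1, 0, -1, 1, 0, 0, -2, 1, 0, 2, -1, 1, 0, 1, -1, 1, -1, -1, -1;
     0, 1, 0, 0, -1, 0, -1, 1, 0, 0, -2, 1, 0, 2, 0, 1, 0, 1, -1, 0, -1, 0, -1;
     0, 2, 1, 0, -1, -1, -2, 0, 0, 1, -1, 1, 0, 2, 0, 0, 1, 2, -1, -1, -1, 0, -2;
     0, -1, -1, 1, 0, 0, 1, 2, 0, -1, -1, 0, -1, 1, 0, 0, -1, 0, 0, 0, 0, 0, 1;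
     0, 0, 0, 0, 0, 0, 0, 0, 0, 0, -1, 0, 0, 1, 0, 0, 0, 0, 0, 0, 0, 0, 0;
     0, 3, 1, 0, 1, -1, -4, -3, 0, 1, -2, -1, 3, 3, 0, 0, 3, 3, -2, 0, 0, -1, -4;
     0, 4, 3, -1, -1, -1, -4, -4, -1, 3, 0, 0, 2, 2, 0, -1, 3, 3, -1, -1, -1, 0, -4;
     1, -4, -9, 5, 6, 0, 4, 5, 0, -9, -8, -8, 0, 5, 1, 4, 0, 1, -4, 5, 5, -4, 4;
     0, -1, -3, 2, 2, 0, 1, 1, 0, -3, -4, -4, 1, 3, 0, 2, 1, 1, -2, 2, 2, -2, 1;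
     0, 1, 2, -1, -1, 0, -1, -1, 0, 2, 2, 2, 0, -1, 0, -1, 0, 0, 1, -1, -1, 1, -1;
     1, -3, -9, 6, 6, 1, 5, 5, 1, -9, -10, -10, 2, 7, 1, 6, 2, 2, -5, 6, 6, -4, 5;
     0, 2, 2, -1, -1, 0, -2, -2, 0, 2, 1, 1, 1, 0, 0, -1, 1, 1, 0, -1, -1, 1, -2]

/-- The inverse of `cyclicBasis`. -/
def cyclicBasisInv : Matrix (Fin 23) (Fin 23) ℤ :=
  !![3, -2, -3, 2, 0, 0, -1, 1, 1, -1, -1, 1, 1, -4, 4, -1, 4, 3, -1, -4, -4, 1, -3;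
     -1, 3, 2, -3, 1, -1, 1, 0, -1, 0, -1, 1, 0, 0, 0, 0, -1, -1, -2, -4, -5, 1, -1;
     3, -5, -4, 4, 0, 1, -1, 0, 1, -1, 0, 1, 0, -3, 3, -1, 4, 4, 1, 0, 2, 0, -3;
     2, -4, -3, 4, -1, 1, -2, 1, 0, 1, 1, -1, 0, -2, 3, -1, 3, 3, 1, 1, 1, 0, -1;
     -1, -1, 0, 1, 0, 0, 0, 0, 0, 2, 1, -2, 0, 1, -1, 0, -1, 0, 2, 4, 6, -1, 1;
     2, -9, -6, 9, -2, 2, -2, 0, 1, 2, 2, -2, 0, -2, 2, -1, 3, 5, 5, 9, 12, -2, 1;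
     -2, 0, 0, 1, -1, 1, -1, 1, 0, 2, 2, -3, 0, 2, -2, 1, -2, -1, 2, 5, 5, -1, 3;
     -2, 4, 3, -4, 1, -1, 2, -1, -1, 0, 0, 0, 0, 2, -2, 0, -3, -3, -1, 0, 0, 0, 1;
     0, 0, 0, 0, 0, 0, 0, 0, 0, -1, 0, 1, -1, 1, -1, 1, 0, -1, 0, 0, 0, 0, 1;
     -3, 7, 6, -7, 1, -2, 2, 0, -1, -1, 0, 0, 0, 3, -3, 1, -4, -5, -3, -4, -6, 1, 1;
     1, -1, -1, 1, 0, 0, 0, 0, 0, 0, -1, 1, 0, -1, 1, -1, 1, 1, 0, 0, 1, 0, -1;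
     1, -3, -2, 3, -1, 1, -1, 0, 1, 0, 0, 0, 0, -1, 1, 0, 2, 2, 1, 0, 1, 0, -1;
     0, 4, 2, -4, 1, -1, 1, 0, 0, -2, -2, 2, 1, -2, 2, -1, 1, -1, -4, -8, -10, 2, -3;
     1, -1, -1, 1, 0, 0, 0, 0, 0, 0, -1, 1, 0, -1, 1, 0, 1, 1, 0, 0, 1, 0, -1;
     1, -3, -2, 3, -1, 1, -1, 0, 0, -1, 1, 0, 0, -1, 1, 0, 2, 2, 1, 0, 1, 0, -1;
     1, -1, -1, 1, 0, 0, -1, 1, 0, 1, 0, -1, 1, -1, 1, -1, 1, 1, 0, 1, 1, 0, -1;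
     -1, -5, -3, 6, -2, 2, -1, -1, 0, 4, 3, -4, -1, 3, -3, 1, -2, 1, 6, 13, 16, -3, 5;
     -1, 1, 1, -1, 0, 0, 0, 0, 1, -1, 0, 0, 0, 1, -1, 0, -1, -1, 0, 0, 0, 0, 1;
     -2, 2, 1, -1, 0, 0, 0, 0, -1, 2, 1, -2, 0, 2, -2, 1, -3, -2, 1, 5, 5, -1, 3;
     -3, 6, 5, -6, 1, -1, 2, -1, -1, -1, 0, 1, -1, 4, -5, 2, -5, -5, -1, -1, -1, 0, 3;
     1, 3, 2, -4, 1, -1, 1, 0, 0, -3, -2, 3, 0, -1, 1, 0, 1, -1, -4, -8, -10, 2, -3;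
     -2, 5, 4, -5, 1, -1, 1, 0, -1, 1, 0, -1, 0, 3, -3, 1, -4, -4, -1, 0, -1, 0, 3;
     2, 0, 0, -1, 1, -1, 1, -1, 1, -3, -3, 4, 0, -3, 3, -1, 3, 2, -3, -9, -9, 2, -5]

/-- First column of the Gram matrix of `L` in the basis `cyclicBasis`. -/
def cyclicGramCol : Fin 23 → ℤ :=
  ![-2, 0, 1, 0, 0, 1, 0, -1, 0, 0, 0, 1, 1, 0, 0, 0, -1, 0, 1, 0, 0, 1, 0]

/-- The permutation matrix of the cyclic shift `i ↦ i + 1`. -/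
def cyclicShift : Matrix (Fin 23) (Fin 23) ℤ := circulant (Pi.single 1 1)

/-- The isometry of `L` that permutes `cyclicBasis` cyclically. -/
def cyclicIsometry : Matrix (Fin 23) (Fin 23) ℤ := cyclicBasis * cyclicShift * cyclicBasisInv

/-- A generator of the sublattice of `L` fixed by `cyclicIsometry`. -/
def invariantVec : Fin 23 → ℤ :=
  ![0, 0, 0, 0, 0, 0, 0, 0, 0, 0, 0, 0, 0, 0, 0, 0, 0, 0, 0, 0, 2, 12, 1]

/-- A basis of the orthogonal complement of `invariantVec` with Gram matrix `gramS`. -/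
def coinvariantBasis : Fin 22 → Fin 23 → ℤ :=
  ![Pi.single 16 1, Pi.single 17 1, Pi.single 18 1, Pi.single 19 1,
    Pi.single 0 1, Pi.single 1 1, Pi.single 2 1, Pi.single 3 1,
    Pi.single 4 1, Pi.single 5 1, Pi.single 6 1, Pi.single 7 1,
    Pi.single 8 1, Pi.single 9 1, Pi.single 10 1, Pi.single 11 1,
    Pi.single 12 1, Pi.single 13 1, Pi.single 14 1, Pi.single 15 1,
    Pi.single 20 1 - Pi.single 21 6, Pi.single 21 1 + Pi.single 22 1]

theorem cyclicBasis_mul_inv : cyclicBasis * cyclicBasisInv = 1 := by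
  decide +kernel

theorem cyclicBasisInv_mul : cyclicBasisInv * cyclicBasis = 1 :=
  mul_eq_one_comm.mp cyclicBasis_mul_inv

theorem transpose_cyclicBasis_mul_gramL_mul :
    cyclicBasisᵀ * (gramL * cyclicBasis) = circulant cyclicGramCol := by
  decide +kernel

theorem cyclicBasis_mulVec_one : cyclicBasis *ᵥ 1 = invariantVec := by
  decide +kernel

theorem cyclicShift_mulVec_apply (x : Fin 23 → ℤ) (i : Fin 23) :
    (cyclicShift *ᵥ x) i = x (i - 1) := by
  have h (j : Fin 23) : (Pi.single 1 1 : Fin 23 → ℤ) (i - j) = if j = i - 1 then 1 else 0 := by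
    rw [Pi.single_apply]
    congr 1
    rw [eq_iff_iff, sub_eq_iff_eq_add, eq_sub_iff_add_eq, add_comm, eq_comm]
  simp [cyclicShift, mulVec, dotProduct, circulant_apply, h]

theorem cyclicShift_pow_mulVec_apply (n : ℕ) (x : Fin 23 → ℤ) (i : Fin 23) :
    (cyclicShift ^ n *ᵥ x) i = x (i - n • 1) := by
  induction n generalizing i with
  | zero => simp
  | succ n ih =>
    rw [pow_succ', ← mulVec_mulVec, cyclicShift_mulVec_apply, ih, succ_nsmul]
    congr 1
    abel

theorem cyclicShift_pow : cyclicShift ^ 23 = 1 := by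
  refine ext_of_mulVec_single fun j => ?_
  ext i
  rw [cyclicShift_pow_mulVec_apply, one_mulVec]
  congr 1
  revert i
  decide

theorem cyclicShift_mulVec_eq_self_iff (x : Fin 23 → ℤ) :
    cyclicShift *ᵥ x = x ↔ ∃ k : ℤ, x = k • 1 := by
  constructor
  · intro h
    refine ⟨x 0, funext fun i => ?_⟩
    have hpow (n : ℕ) : cyclicShift ^ n *ᵥ x = x := by
      induction n with
      | zero => simp
      | succ n ih => rw [pow_succ, ← mulVec_mulVec, h, ih]
    have h0 : i - (i : ℕ) • 1 = 0 := by
      clear hpow h x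
      revert i
      decide
    have hi := congrFun (hpow i) i
    rw [cyclicShift_pow_mulVec_apply, h0] at hi
    simpa using hi.symm
  · rintro ⟨k, rfl⟩
    ext i
    simp [cyclicShift_mulVec_apply]

theorem transpose_cyclicShift_mul_self : cyclicShiftᵀ * cyclicShift = 1 := by
  decide +kernel

theorem transpose_cyclicShift_mul_circulant_mul (c : Fin 23 → ℤ) :
    cyclicShiftᵀ * circulant c * cyclicShift = circulant c := by
  rw [Matrix.mul_assoc, cyclicShift, circulant_mul_comm, ← Matrix.mul_assoc, ← cyclicShift,
    transpose_cyclicShift_mul_self, Matrix.one_mul]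

theorem transpose_cyclicIsometry_mul_gramL_mul :
    cyclicIsometryᵀ * gramL * cyclicIsometry = gramL := by
  calc cyclicIsometryᵀ * gramL * cyclicIsometry
      = cyclicBasisInvᵀ * (cyclicShiftᵀ * (cyclicBasisᵀ * (gramL * cyclicBasis)) * cyclicShift) *
          cyclicBasisInv := by
        simp only [cyclicIsometry, transpose_mul, Matrix.mul_assoc]
    _ = (cyclicBasis * cyclicBasisInv)ᵀ * gramL * (cyclicBasis * cyclicBasisInv) := by
        rw [transpose_cyclicBasis_mul_gramL_mul, transpose_cyclicShift_mul_circulant_mul,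
          ← transpose_cyclicBasis_mul_gramL_mul]
        simp only [transpose_mul, Matrix.mul_assoc]
    _ = gramL := by simp [cyclicBasis_mul_inv]

theorem cyclicIsometry_pow : cyclicIsometry ^ 23 = 1 := by
  have h (n : ℕ) : cyclicIsometry ^ n = cyclicBasis * cyclicShift ^ n * cyclicBasisInv := by
    induction n with
    | zero => simp [cyclicBasis_mul_inv]
    | succ n ih =>
      calc cyclicIsometry ^ (n + 1)
          = cyclicBasis * cyclicShift ^ n * (cyclicBasisInv * cyclicBasis) * cyclicShift *
              cyclicBasisInv := by
            rw [pow_succ, ih, cyclicIsometry]; simp only [Matrix.mul_assoc]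
        _ = _ := by rw [cyclicBasisInv_mul, pow_succ]; simp only [Matrix.mul_assoc, Matrix.one_mul]
  rw [h, cyclicShift_pow, Matrix.mul_one, cyclicBasis_mul_inv]

theorem cyclicIsometry_mulVec_eq_self_iff (x : Fin 23 → ℤ) :
    cyclicIsometry *ᵥ x = x ↔ ∃ k : ℤ, x = k • invariantVec := by
  have hx (y : Fin 23 → ℤ) : x = cyclicBasis *ᵥ y ↔ cyclicBasisInv *ᵥ x = y := by
    constructor
    · rintro rfl
      rw [mulVec_mulVec, cyclicBasisInv_mul, one_mulVec]
    · rintro rfl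
      rw [mulVec_mulVec, cyclicBasis_mul_inv, one_mulVec]
  rw [cyclicIsometry, ← mulVec_mulVec, ← mulVec_mulVec, eq_comm, hx, eq_comm,
    cyclicShift_mulVec_eq_self_iff]
  refine exists_congr fun k => ?_
  rw [← hx, mulVec_smul, cyclicBasis_mulVec_one]

theorem cyclicIsometry_ne_one : cyclicIsometry ≠ 1 := by
  intro h
  obtain ⟨k, hk⟩ := (cyclicIsometry_mulVec_eq_self_iff (Pi.single 0 1)).mp (by rw [h, one_mulVec])
  simpa [invariantVec] using congrFun hk 0

theorem invariantVec_dotProduct_gramL_mulVec (x : Fin 23 → ℤ) :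
    invariantVec ⬝ᵥ gramL *ᵥ x = 12 * x 20 + 2 * x 21 - 2 * x 22 := by
  have h : invariantVec ᵥ* gramL =
      ![0, 0, 0, 0, 0, 0, 0, 0, 0, 0, 0, 0, 0, 0, 0, 0, 0, 0, 0, 0, 12, 2, -2] := by
    decide +kernel
  rw [dotProduct_mulVec, h]
  simp [dotProduct, Fin.sum_univ_succ]
  ring

theorem coinvariantBasis_gram :
    of coinvariantBasis * (gramL * (of coinvariantBasis)ᵀ) = gramS := by
  decide +kernel

theorem sum_smul_coinvariantBasis (c : Fin 22 → ℤ) :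
    ∑ i, c i • coinvariantBasis i =
      ![c 4, c 5, c 6, c 7, c 8, c 9, c 10, c 11, c 12, c 13, c 14, c 15, c 16, c 17, c 18, c 19,
        c 0, c 1, c 2, c 3, c 20, c 21 - 6 * c 20, c 21] := by
  ext j
  fin_cases j <;> simp [Fin.sum_univ_succ, coinvariantBasis]
  ring

/-- The lattice `L = E8 ⊕ E8 ⊕ U ⊕ U ⊕ U ⊕ ⟨-2⟩` admits an isometry of
order `23` whose invariant sublattice is `⟨46⟩` (free of rank one, generated by a vector
`t` of square `46`) and whose co-invariant sublattice (the orthogonal complement of `t`)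
is isometric to `U ⊕ U ⊕ E8 ⊕ E8 ⊕ K₂₃`. -/
theorem stmt13 :
    ∃ M : Matrix (Fin 23) (Fin 23) ℤ,
      Mᵀ * gramL * M = gramL ∧ M ^ 23 = 1 ∧ M ≠ 1 ∧
      ∃ t : Fin 23 → ℤ,
        t ⬝ᵥ gramL.mulVec t = 46 ∧
        (∀ x : Fin 23 → ℤ, M.mulVec x = x ↔ ∃ k : ℤ, x = k • t) ∧
        ∃ b : Fin 22 → (Fin 23 → ℤ),
          (∀ i, t ⬝ᵥ gramL.mulVec (b i) = 0) ∧
          (∀ x : Fin 23 → ℤ, t ⬝ᵥ gramL.mulVec x = 0 ↔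
            ∃ c : Fin 22 → ℤ, x = ∑ i, c i • b i) ∧
          (∀ c : Fin 22 → ℤ, ∑ i, c i • b i = 0 → c = 0) ∧
          (∀ i j, b i ⬝ᵥ gramL.mulVec (b j) = gramS i j) := by
  refine ⟨cyclicIsometry, transpose_cyclicIsometry_mul_gramL_mul, cyclicIsometry_pow,
    cyclicIsometry_ne_one, invariantVec, ?_, cyclicIsometry_mulVec_eq_self_iff,
    coinvariantBasis, ?_, ?_, ?_, ?_⟩
  · rw [invariantVec_dotProduct_gramL_mulVec]
    decide
  · intro i
    rw [invariantVec_dotProduct_gramL_mulVec]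
    revert i
    decide
  · intro x
    rw [invariantVec_dotProduct_gramL_mulVec]
    simp only [sum_smul_coinvariantBasis]
    constructor
    · intro h
      refine ⟨![x 16, x 17, x 18, x 19, x 0, x 1, x 2, x 3, x 4, x 5, x 6, x 7, x 8, x 9, x 10,
        x 11, x 12, x 13, x 14, x 15, x 20, x 22], ?_⟩
      ext j
      fin_cases j
      all_goals first | rfl | (simp; lia)
    · rintro ⟨c, rfl⟩
      simp
      ring
  · intro c h
    rw [sum_smul_coinvariantBasis] at h
    simp only [funext_iff, Fin.forall_fin_succ] at h
    ext j
    fin_cases j <;> simp at h ⊢ <;> lia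
  · exact fun i j => congrFun₂ coinvariantBasis_gram i j
end

section
/- Let K = ℚ(ζ₂₃) be the 23rd cyclotomic field, μ = ζ₂₃ + ζ₂₃^{−1}, and set α₀ = (1/23)·(−μ⁷ + μ⁶ + 7μ⁵ − 6μ⁴ − 14μ³ + 9μ² + 7μ − 2) ∈ K. Then α₀ is fixed by complex conjugation (the ℚ-algebra automorphism with ζ₂₃ ↦ ζ₂₃^{−1}) and its field norm satisfies N_{K/ℚ}(α₀) = 1/23²⁰ (equivalently, α₀ lies in the maximal real subfield F = ℚ(μ) and N_{F/ℚ}(α₀) = ±1/23¹⁰). -/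
/-- For an odd prime `p` and a primitive `p`-th root of unity `ζ`, the element `ζ - 1` has norm `p`
in the `p`-th cyclotomic field over `ℚ`. -/
theorem norm_primitiveRoot_sub_one {K : Type*} [Field K] [Algebra ℚ K] {p : ℕ} (hp : p.Prime)
    (hp2 : p ≠ 2) [IsCyclotomicExtension {p} ℚ K] {ζ : K} (hζ : IsPrimitiveRoot ζ p) :
    Algebra.norm ℚ (ζ - 1) = p := by
  have : Fact p.Prime := ⟨hp⟩
  exact hζ.norm_sub_one_of_prime_ne_two' (Polynomial.cyclotomic.irreducible_rat hp.pos) hp2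

/-- In `K = ℚ(ζ₂₃)` with `μ = ζ₂₃ + ζ₂₃⁻¹`, the element
`α₀ = (1/23)(-μ⁷ + μ⁶ + 7μ⁵ - 6μ⁴ - 14μ³ + 9μ² + 7μ - 2)` is fixed by complex
conjugation and has field norm `N_{K/ℚ}(α₀) = 1 / 23²⁰`. -/
theorem stmt16 (K : Type*) [Field K] [Algebra ℚ K] [IsCyclotomicExtension {23} ℚ K]
    (ζ : K) (hζ : IsPrimitiveRoot ζ 23)
    (conj : K ≃ₐ[ℚ] K) (hconj : conj ζ = ζ⁻¹)
    (μ α₀ : K) (hμ : μ = ζ + ζ⁻¹)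
    (hα₀ : α₀ = (23 : K)⁻¹ *
      (-μ ^ 7 + μ ^ 6 + 7 * μ ^ 5 - 6 * μ ^ 4 - 14 * μ ^ 3 + 9 * μ ^ 2 + 7 * μ - 2)) :
    conj α₀ = α₀ ∧ Algebra.norm ℚ α₀ = 1 / 23 ^ 20 := by
  have hprime : Nat.Prime 23 := by norm_num
  have hirr := Polynomial.cyclotomic.irreducible_rat hprime.pos
  have hζ0 : ζ ≠ 0 := hζ.ne_zero (by norm_num)
  have hconjμ : conj μ = μ := by
    rw [hμ, map_add, map_inv₀, hconj, inv_inv, add_comm]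
  refine ⟨by simp [hα₀, hconjμ, map_ofNat conj], ?_⟩
  have hfactor : α₀ = algebraMap ℚ K (-23⁻¹) * (ζ⁻¹ ^ 7 * ((ζ - 1) * (ζ ^ 13 - 1))) := by
    rw [hα₀, hμ, map_neg, map_inv₀, map_ofNat, neg_mul, ← mul_neg]
    congr 1
    field_simp
    ring
  have hfinrank : Module.finrank ℚ K = 22 := by
    rw [IsCyclotomicExtension.finrank K hirr, Nat.totient_prime hprime]
  have hnormζ : Algebra.norm ℚ ζ⁻¹ = 1 := hζ.inv.norm_eq_one (by norm_num) hirr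
  rw [hfactor, map_mul, Algebra.norm_algebraMap, hfinrank, map_mul, map_mul, map_pow,
    hnormζ, norm_primitiveRoot_sub_one hprime (by norm_num) hζ,
    norm_primitiveRoot_sub_one hprime (by norm_num) (hζ.pow_of_coprime 13 (by norm_num))]
  norm_num
end

section
/- Let A be the 22×22 symmetric integer matrix with entries A_{ij} = c(|i−j|), where (c(0), …, c(21)) = (−2, 3, 0, 3, 0, 2, 1, 0, −1, −2, −2, −3, −3, −2, −2, −1, 0, 1, 2, 0, 3, 0), let ξ = e^{2πi/23} ∈ ℂ, and define ω ∈ ℂ²² by ω_i = Σ_{j=0}^{21−i} ξ^j for i = 0, 1, …, 21. Then ωᵀ·A·ω = 0 and ωᵀ·A·ω̄ is a positive real number (where ω̄ is the componentwise complex conjugate); that is, the point [ω] lies in the period domain Ω of the lattice with Gram matrix A. -/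
open Matrix Complex

/-- The primitive 23rd root of unity `ξ = e^{2πi/23}`. -/
noncomputable def xi : ℂ := Complex.exp (2 * Real.pi * Complex.I / 23)

/-- The period vector `ω ∈ ℂ²²`, `ω_i = ∑_{j=0}^{21-i} ξ^j`. -/
noncomputable def omega : Fin 22 → ℂ := fun i => ∑ j ∈ Finset.range (22 - (i : ℕ)), xi ^ j

/-- The first row of `gramA` applied to `omega` is `∑ m, rowCoeff m * ξ ^ m`. -/
def rowCoeff (m : ZMod 23) : ℤ :=
  ∑ j : Fin 22, if m.val < 22 - (j : ℕ) then gramA 0 j else 0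

/-- Coefficients of the real cyclotomic integer `s` with `ωᵀ A ω̄ = 23 s`. -/
def pairingCoeff (m : ZMod 23) : ℤ :=
  [51, 52, 50, 48, 43, 38, 31, 23, 15, 8, 3, 0, 0, 3, 8, 15, 23, 31, 38, 43, 48, 50, 52].getD
    m.val 0

/-- The additive character of `ZMod 23` with `1 ↦ ξ`. -/
local notation "χ" => (ZMod.stdAddChar : AddChar (ZMod 23) ℂ)

theorem xi_pow (n : ℕ) : xi ^ n = χ (n : ZMod 23) := by
  have h := ZMod.stdAddChar_coe (N := 23) (n : ℤ)
  push_cast at h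
  rw [h, xi, ← Complex.exp_nat_mul]
  congr 1
  ring

theorem sum_stdAddChar_mul {a : ZMod 23} (ha : a ≠ 0) : ∑ m, χ (a * m) = 0 := by
  have : Fact (Nat.Prime 23) := ⟨by norm_num⟩
  have h := AddChar.sum_mulShift (ψ := χ) a (ZMod.isPrimitive_stdAddChar 23)
  simpa [ha, mul_comm] using h

theorem stdAddChar_one_ne_one : χ 1 ≠ 1 := by
  intro h
  rw [← AddChar.map_zero_eq_one χ] at h
  exact absurd (ZMod.injective_stdAddChar h) (by decide)

theorem conj_stdAddChar (m : ZMod 23) : starRingEnd ℂ (χ m) = χ (-m) :=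
  (AddChar.map_neg_eq_conj χ m).symm

theorem omega_eq_sum (i : Fin 22) :
    omega i = ∑ k : ZMod 23, if k.val < 22 - (i : ℕ) then χ k else 0 := by
  have h : ∀ k : Fin 23, xi ^ (k : ℕ) = χ k := fun k => by
    rw [xi_pow]
    congr 1
    exact ZMod.natCast_zmod_val (n := 23) k
  rw [omega, ← Finset.sum_filter]
  refine Finset.sum_bij' (fun j _ => (j : ZMod 23)) (fun k _ => k.val) ?_ ?_ ?_ ?_ ?_
  · intro j hj
    simp only [Finset.mem_range] at hj
    simpa [ZMod.val_natCast, Nat.mod_eq_of_lt (show j < 23 by lia)] using hj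
  · intro k hk
    simpa using hk
  · intro j hj
    simp only [Finset.mem_range] at hj
    simp [ZMod.val_natCast, Nat.mod_eq_of_lt (show j < 23 by lia)]
  · intro k _
    exact ZMod.natCast_zmod_val k
  · intro j _
    exact xi_pow j

theorem sub_one_mul_omega (i : Fin 22) :
    (χ 1 - 1) * omega i = χ (-1 - (i : ℕ)) - 1 := by
  have h := mul_geom_sum xi (22 - (i : ℕ))
  have hx : xi = χ 1 := by simpa using xi_pow 1
  rw [omega, ← hx, h, xi_pow, Nat.cast_sub (by lia)]
  rfl

theorem gramA_row_sum (i : Fin 22) (k : ZMod 23) :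
    (∑ j : Fin 22, if k.val < 22 - (j : ℕ) then gramA i j else 0) =
      rowCoeff ((i : ℕ) + k) - rowCoeff ((i : ℕ) - 1) := by
  revert i k
  decide +kernel

theorem gramA_mulVec_omega (i : Fin 22) :
    (gramA.map ((↑) : ℤ → ℂ)).mulVec omega i = (∑ m, rowCoeff m * χ m) * χ (-(i : ℕ)) := by
  calc (gramA.map ((↑) : ℤ → ℂ)).mulVec omega i
      = ∑ k : ZMod 23, ((∑ j : Fin 22, if k.val < 22 - (j : ℕ) then gramA i j else 0 : ℤ) : ℂ) *
          χ k := by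
        simp only [mulVec, dotProduct, omega_eq_sum, Finset.mul_sum, map_apply]
        rw [Finset.sum_comm]
        refine Finset.sum_congr rfl fun k _ => ?_
        push_cast
        rw [Finset.sum_mul]
        refine Finset.sum_congr rfl fun j _ => ?_
        split_ifs <;> simp
    _ = ∑ k : ZMod 23, rowCoeff ((i : ℕ) + k) * χ k := by
        have h := sum_stdAddChar_mul (a := 1) (by decide)
        simp only [one_mul] at h
        simp only [gramA_row_sum, Int.cast_sub, sub_mul, Finset.sum_sub_distrib, ← Finset.mul_sum,
          h, mul_zero, sub_zero]
    _ = ∑ m, rowCoeff m * χ m * χ (-(i : ℕ)) := by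
        refine Fintype.sum_equiv (Equiv.addLeft ((i : ℕ) : ZMod 23)) _ _ fun k => ?_
        rw [mul_assoc, ← AddChar.map_add_eq_mul]
        simp
    _ = _ := by rw [Finset.sum_mul]

theorem sum_fin_eq_sum_zmod (f : ZMod 23 → ℂ) (h : f (-1) = 0) :
    ∑ i : Fin 22, f (i : ℕ) = ∑ m, f m := by
  have h' := Fin.sum_univ_castSucc (n := 22) (fun m : Fin 23 => f m)
  refine Eq.trans ?_ h'.symm
  have hl : f (Fin.last 22 : Fin 23) = 0 := h
  rw [hl, add_zero]
  have hi : ∀ i : Fin 22, ((i : ℕ) : ZMod 23) = (show ZMod 23 from i.castSucc) := by decide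
  exact Finset.sum_congr rfl fun i _ => congrArg f (hi i)

theorem sum_omega_mul_stdAddChar_neg : ∑ i : Fin 22, omega i * χ (-(i : ℕ)) = 0 := by
  refine (mul_eq_zero.mp ?_).resolve_left (sub_ne_zero.mpr stdAddChar_one_ne_one)
  simp only [Finset.mul_sum, ← mul_assoc, sub_one_mul_omega]
  rw [sum_fin_eq_sum_zmod (fun m => (χ (-1 - m) - 1) * χ (-m)) (by simp)]
  have h₁ := sum_stdAddChar_mul (a := -1) (by decide)
  have h₂ := sum_stdAddChar_mul (a := -2) (by decide)
  have h : ∀ m : ZMod 23, (χ (-1 - m) - 1) * χ (-m) = χ (-1) * χ (-2 * m) - χ (-1 * m) := by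
    intro m
    rw [sub_mul, ← AddChar.map_add_eq_mul, ← AddChar.map_add_eq_mul]
    ring_nf
  simp only [h, Finset.sum_sub_distrib, ← Finset.mul_sum, h₁, h₂]
  simp

theorem sum_omega_mul_stdAddChar :
    (χ 1 - 1) * ∑ i : Fin 22, omega i * χ (i : ℕ) = 23 * χ (-1) := by
  simp only [Finset.mul_sum, ← mul_assoc, sub_one_mul_omega]
  rw [sum_fin_eq_sum_zmod (fun m => (χ (-1 - m) - 1) * χ m) (by simp)]
  have h₁ := sum_stdAddChar_mul (a := 1) (by decide)
  have h : ∀ m : ZMod 23, (χ (-1 - m) - 1) * χ m = χ (-1) - χ (1 * m) := by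
    intro m
    rw [sub_mul, ← AddChar.map_add_eq_mul]
    ring_nf
  simp only [h, Finset.sum_sub_distrib, h₁]
  simp [ZMod.card]

theorem rowCoeff_neg (m : ZMod 23) :
    rowCoeff (-m) = pairingCoeff (m - 2) - pairingCoeff (m - 1) - 1 := by
  revert m
  decide +kernel

theorem conj_sum_rowCoeff :
    starRingEnd ℂ (∑ m, rowCoeff m * χ m) =
      χ 1 * (χ 1 - 1) * ∑ m, pairingCoeff m * χ m := by
  have shift : ∀ a : ZMod 23,
      ∑ m, (pairingCoeff (m - a) : ℂ) * χ m = χ a * ∑ m, pairingCoeff m * χ m := by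
    intro a
    rw [Finset.mul_sum]
    refine Fintype.sum_equiv (Equiv.subRight a) _ _ fun m => ?_
    rw [mul_left_comm, ← AddChar.map_add_eq_mul]
    simp
  have h := sum_stdAddChar_mul (a := 1) (by decide)
  have h₂ : χ 2 = χ 1 * χ 1 := by rw [← AddChar.map_add_eq_mul]; rfl
  simp only [one_mul] at h
  calc starRingEnd ℂ (∑ m, rowCoeff m * χ m) = ∑ m, (rowCoeff m : ℂ) * χ (-m) := by
        simp only [map_sum, map_mul, conj_stdAddChar, map_intCast]
    _ = ∑ m, (rowCoeff (-m) : ℂ) * χ m :=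
        Fintype.sum_equiv (Equiv.neg _) _ _ fun m => by simp
    _ = _ := by
        simp only [rowCoeff_neg, Int.cast_sub, sub_mul, Finset.sum_sub_distrib, shift, h₂,
          Int.cast_one, one_mul, h]
        ring

theorem pow_add_pow_of_mul_eq_one {R : Type*} [CommRing R] {x y : R} (h : x * y = 1) (n : ℕ) :
    x ^ (n + 2) + y ^ (n + 2) = (x + y) * (x ^ (n + 1) + y ^ (n + 1)) - (x ^ n + y ^ n) := by
  linear_combination (-(x ^ n + y ^ n)) * h

theorem sum_pairingCoeff_eq_eval {t : ℂ} (ht : χ 1 + χ (-1) = t) :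
    ∑ m, pairingCoeff m * χ m =
      -1 + 9 * t - 8 * t ^ 2 - 60 * t ^ 3 + 7 * t ^ 4 + 93 * t ^ 5 + 16 * t ^ 6 - 49 * t ^ 7
        - 15 * t ^ 8 + 8 * t ^ 9 + 3 * t ^ 10 := by
  have hxy : χ 1 * χ (-1) = 1 := by rw [← AddChar.map_add_eq_mul]; simp
  have hx : ∀ n : ℕ, χ (n : ZMod 23) = χ 1 ^ n := fun n => by
    rw [← AddChar.map_nsmul_eq_pow]; simp
  have hy : ∀ n : ℕ, χ (-n : ZMod 23) = χ (-1) ^ n := fun n => by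
    rw [← AddChar.map_nsmul_eq_pow]; simp
  have hsum : ∑ m, pairingCoeff m * χ m =
      51 + ∑ k ∈ Finset.range 10,
        (pairingCoeff ((k + 1 : ℕ) : ZMod 23) : ℂ) * (χ 1 ^ (k + 1) + χ (-1) ^ (k + 1)) := by
    have hc : ∀ m : ZMod 23, pairingCoeff (-m) = pairingCoeff m := by decide +kernel
    have hsplit : (Finset.univ : Finset (ZMod 23)) =
        {0, 11, -11} ∪ ((Finset.range 10).image (fun k => ((k + 1 : ℕ) : ZMod 23)) ∪
          (Finset.range 10).image (fun k => (-(k + 1 : ℕ) : ZMod 23))) := by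
      decide +kernel
    rw [hsplit, Finset.sum_union (by decide +kernel), Finset.sum_union (by decide +kernel),
      Finset.sum_image (by decide +kernel), Finset.sum_image (by decide +kernel),
      ← Finset.sum_add_distrib]
    congr 1
    · have h₀ : pairingCoeff 0 = 51 := by decide
      have h₁ : pairingCoeff 11 = 0 := by decide
      rw [Finset.sum_insert (by decide), Finset.sum_pair (by decide), hc, h₀, h₁]
      simp
    · refine Finset.sum_congr rfl fun k _ => ?_
      rw [hc, hx, hy, mul_add]
  have p (n : ℕ) := pow_add_pow_of_mul_eq_one hxy n
  have hcoeff : ∀ k : Fin 10, pairingCoeff ((k + 1 : ℕ) : ZMod 23) =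
      ![52, 50, 48, 43, 38, 31, 23, 15, 8, 3] k := by decide +kernel
  rw [hsum, Finset.sum_range]
  simp only [hcoeff, Fin.sum_univ_succ]
  simp [p, ht]
  ring

theorem stdAddChar_one_add_neg_one :
    χ 1 + χ (-1) = ((2 * Real.cos (2 * Real.pi / 23) : ℝ) : ℂ) := by
  have hx : χ 1 = xi := by simpa using (xi_pow 1).symm
  have hθ : xi = Complex.exp ((2 * Real.pi / 23 : ℝ) * Complex.I) := by
    rw [xi]
    push_cast
    congr 1
    ring
  rw [← conj_stdAddChar, Complex.add_conj, hx, hθ, Complex.exp_ofReal_mul_I_re]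

theorem cos_two_pi_div_23_gt : 1.9 ≤ 2 * Real.cos (2 * Real.pi / 23) := by
  have h := Real.one_sub_sq_div_two_le_cos (x := 2 * Real.pi / 23)
  nlinarith [Real.pi_lt_d2, Real.pi_pos]

theorem eval_pos_of_ge {t : ℝ} (ht : 1.9 ≤ t) :
    0 < -1 + 9 * t - 8 * t ^ 2 - 60 * t ^ 3 + 7 * t ^ 4 + 93 * t ^ 5 + 16 * t ^ 6 - 49 * t ^ 7
        - 15 * t ^ 8 + 8 * t ^ 9 + 3 * t ^ 10 := by
  obtain ⟨u, hu, rfl⟩ : ∃ u : ℝ, 0 ≤ u ∧ t = u + 1.9 := ⟨t - 1.9, by linarith, by ring⟩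
  ring_nf
  positivity

theorem omega_dotProduct_conj :
    omega ⬝ᵥ (gramA.map ((↑) : ℤ → ℂ)).mulVec (fun i => starRingEnd ℂ (omega i)) =
      23 * ∑ m, pairingCoeff m * χ m := by
  have hrow : ∀ i, (gramA.map ((↑) : ℤ → ℂ)).mulVec (fun i => starRingEnd ℂ (omega i)) i =
      starRingEnd ℂ (∑ m, rowCoeff m * χ m) * χ (i : ℕ) := by
    intro i
    have h := congrArg (starRingEnd ℂ) (gramA_mulVec_omega i)
    rw [map_mul, conj_stdAddChar, neg_neg] at h
    rw [← h]
    simp [mulVec, dotProduct]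
  have hxy : χ 1 * χ (-1) = 1 := by rw [← AddChar.map_add_eq_mul]; simp
  have hsum : omega ⬝ᵥ (gramA.map ((↑) : ℤ → ℂ)).mulVec (fun i => starRingEnd ℂ (omega i)) =
      starRingEnd ℂ (∑ m, rowCoeff m * χ m) * ∑ i : Fin 22, omega i * χ (i : ℕ) := by
    rw [dotProduct, Finset.mul_sum]
    exact Finset.sum_congr rfl fun i _ => by rw [hrow]; ring
  rw [hsum, conj_sum_rowCoeff]
  linear_combination (χ 1 * ∑ m, pairingCoeff m * χ m) * sum_omega_mul_stdAddChar +
    (23 * ∑ m, pairingCoeff m * χ m) * hxy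

/-- The period vector `ω` satisfies `ωᵀ A ω = 0` and `ωᵀ A ω̄` is a
positive real number; that is, `[ω]` lies in the period domain of the lattice with Gram
matrix `A`. -/
theorem stmt17 :
    omega ⬝ᵥ (gramA.map ((↑) : ℤ → ℂ)).mulVec omega = 0 ∧
      ∃ r : ℝ, 0 < r ∧
        omega ⬝ᵥ (gramA.map ((↑) : ℤ → ℂ)).mulVec (fun i => starRingEnd ℂ (omega i)) = (r : ℂ) := by
  refine ⟨?_, _, mul_pos (by norm_num : (0 : ℝ) < 23) (eval_pos_of_ge cos_two_pi_div_23_gt), ?_⟩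
  · calc omega ⬝ᵥ (gramA.map ((↑) : ℤ → ℂ)).mulVec omega
        = (∑ m, rowCoeff m * χ m) * ∑ i : Fin 22, omega i * χ (-(i : ℕ)) := by
          rw [dotProduct, Finset.mul_sum]
          exact Finset.sum_congr rfl fun i _ => by rw [gramA_mulVec_omega]; ring
      _ = 0 := by rw [sum_omega_mul_stdAddChar_neg, mul_zero]
  · rw [omega_dotProduct_conj, sum_pairingCoeff_eq_eval stdAddChar_one_add_neg_one]
    push_cast
    rfl
end

section
/- Let A be the 22×22 symmetric integer matrix with entries A_{ij} = c(|i−j|), where (c(0), …, c(21)) = (−2, 3, 0, 3, 0, 2, 1, 0, −1, −2, −2, −3, −3, −2, −2, −1, 0, 1, 2, 0, 3, 0), let ξ = e^{2πi/23} ∈ ℂ, and define ω ∈ ℂ²² by ω_i = Σ_{j=0}^{21−i} ξ^j for i = 0, 1, …, 21. If λ ∈ ℤ²² satisfies λᵀ·A·ω = 0, then λ = 0. In other words, no nonzero integral vector of the lattice (ℤ²², A) is orthogonal to the period vector ω. -/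
open Matrix Complex

open Polynomial in
/-- An integer polynomial of degree less than `φ(n)` that vanishes at a primitive `n`-th root of
unity is zero. -/
theorem eq_zero_of_aeval_primitiveRoot {K : Type*} [Field K] [CharZero K] {ζ : K} {n : ℕ}
    (hζ : IsPrimitiveRoot ζ n) (hn : 0 < n) {p : ℤ[X]} (hp : aeval ζ p = 0)
    (hdeg : p.natDegree < n.totient) : p = 0 := by
  have hdvd : cyclotomic n ℤ ∣ p := by
    rw [cyclotomic_eq_minpoly hζ hn]
    exact minpoly.isIntegrallyClosed_dvd (hζ.isIntegral hn) hp
  exact eq_zero_of_dvd_of_natDegree_lt hdvd (by rwa [natDegree_cyclotomic])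

theorem xi_isPrimitiveRoot : IsPrimitiveRoot xi 23 := by
  simpa [xi] using Complex.isPrimitiveRoot_exp 23 (by norm_num)

open Polynomial in
/-- The coordinates of the period vector are linearly independent over `ℤ`. -/
theorem linearIndependent_omega : LinearIndependent ℤ omega := by
  rw [Fintype.linearIndependent_iff]
  intro μ hμ k
  set P : ℤ[X] := ∑ i : Fin 22, C (μ i) * ∑ j ∈ Finset.range (22 - (i : ℕ)), X ^ j with hP
  have hdeg : P.natDegree < Nat.totient 23 := by
    rw [Nat.totient_prime (by norm_num)]
    refine Nat.lt_succ_of_le (natDegree_sum_le_of_forall_le _ _ fun i _ => ?_)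
    refine (natDegree_C_mul_le _ _).trans (natDegree_sum_le_of_forall_le _ _ fun j hj => ?_)
    rw [natDegree_X_pow]
    have := Finset.mem_range.mp hj
    omega
  have hzero : P = 0 := by
    refine eq_zero_of_aeval_primitiveRoot xi_isPrimitiveRoot (by norm_num) ?_ hdeg
    simpa [hP, omega] using hμ
  have htel : ∑ i : Fin 22, C (μ i) * (X ^ (22 - (i : ℕ)) - 1) = 0 := by
    rw [← zero_mul (X - 1), ← hzero, hP, Finset.sum_mul]
    exact Finset.sum_congr rfl fun i _ => by rw [mul_assoc, geom_sum_mul]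
  have hcoeff := congrArg (fun p => coeff p (22 - (k : ℕ))) htel
  have hk : 22 - (k : ℕ) ≠ 0 := by omega
  have hinj : ∀ i : Fin 22, 22 - (k : ℕ) = 22 - (i : ℕ) ↔ k = i := by
    intro i
    rw [Fin.ext_iff]
    omega
  simpa [finsetSum_coeff, coeff_X_pow, coeff_one, hk, hinj] using hcoeff

/-- The inverse of `gramA` modulo 2; row `i` is the binary expansion of the `i`-th entry of the
list. -/
def gramAInvModTwo : Matrix (Fin 22) (Fin 22) (ZMod 2) :=
  Matrix.of fun i j =>
    if ([4187134, 4185085, 4172795, 4148215, 4099055, 4000735, 3804095, 3410815,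
        2624255, 1051135, 2093056, 1022, 4187138, 4183045, 4174859, 4158487,
        4125743, 4060255, 3929279, 3667327, 3143423, 2093567].getD i 0).testBit j then 1 else 0

theorem gramA_mul_gramAInvModTwo :
    gramA.map (Int.castRingHom (ZMod 2)) * gramAInvModTwo = 1 := by
  decide +kernel

/-- The Gram matrix is nondegenerate: its determinant is odd. -/
theorem det_gramA_ne_zero : gramA.det ≠ 0 := by
  intro h
  have hdet := congrArg Matrix.det gramA_mul_gramAInvModTwo
  rw [Matrix.det_mul, ← RingHom.mapMatrix_apply, ← RingHom.map_det, h] at hdet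
  simp at hdet

/-- No nonzero integral vector of the lattice `(ℤ²², A)` is orthogonal
to the period vector `ω`: if `λᵀ A ω = 0` for `λ ∈ ℤ²²`, then `λ = 0`. -/
theorem stmt18 (lam : Fin 22 → ℤ)
    (h : (fun i => (lam i : ℂ)) ⬝ᵥ (gramA.map ((↑) : ℤ → ℂ)).mulVec omega = 0) :
    lam = 0 := by
  have hsum : ∑ i, (lam ᵥ* gramA) i • omega i = 0 := by
    rw [Matrix.dotProduct_mulVec] at h
    simpa [dotProduct, Matrix.vecMul] using h
  refine Matrix.eq_zero_of_vecMul_eq_zero det_gramA_ne_zero (funext ?_)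
  exact Fintype.linearIndependent_iff.mp linearIndependent_omega _ hsum
end
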